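/- Explicit bound on the determining wavenumber in the critical case from a Hölder bound: let ν > 0, c₀ > 0, R ≥ 0, 0 < h < 1, and r > 2/h, and work on the torus 𝕋² = (ℝ/ℤ)² with λ_q = 2^q. Let (θ_p)_{p≥−1} be measurable functions on 𝕋² with ‖θ_p‖_{L^∞(𝕋²)} ≤ λ_p^{−h} R for all p ≥ −1. Then for every integer q ≥ −1 with λ_q ≥ max{ ((r+1)² R/(2c₀ν))^{1/(h − 2/r)}, ((1 − 2^{h−1})^{−1} (r+1)² R/(c₀ν))^{1/h} }, one has: (i) λ_p^{2/r} ‖θ_p‖_{L^r(𝕋²)} ≤ 2c₀ν/(r+1)² for every p > q, and (ii) λ_q^{−1} ∑_{p=−1}^{q} λ_p ‖θ_p‖_{L^∞(𝕋²)} ≤ c₀ν/(r+1)². -/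

import Mathlib

open MeasureTheory Complex Real
open scoped ENNReal

noncomputable section

instance : Fact ((0 : ℝ) < 1) := ⟨one_pos⟩

/-- The dyadic wavenumber `λ_q = 2^q` (unit torus). -/
def lamq (q : ℤ) : ℝ := 2 ^ q

lemma lamq_pos (q : ℤ) : 0 < lamq q := zpow_pos two_pos q

lemma lamq_mono {p q : ℤ} (hpq : p ≤ q) : lamq p ≤ lamq q :=
  zpow_le_zpow_right₀ one_le_two hpq

lemma lamq_add_one (q : ℤ) : lamq (q + 1) = 2 * lamq q := by
  simp only [lamq]
  rw [zpow_add_one₀ two_ne_zero, mul_comm]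

/-- A dyadic geometric sum is controlled by its last term. -/
lemma sum_lamq_rpow_le {h : ℝ} (hh1 : h < 1) {q : ℤ} (hq : -1 ≤ q) :
    ∑ p ∈ Finset.Icc (-1 : ℤ) q, lamq p ^ (1 - h) ≤
      (1 - (2 : ℝ) ^ (h - 1))⁻¹ * lamq q ^ (1 - h) := by
  have ha0 : (0 : ℝ) < 2 ^ (h - 1) := Real.rpow_pos_of_pos two_pos _
  have ha1 : (2 : ℝ) ^ (h - 1) < 1 :=
    Real.rpow_lt_one_of_one_lt_of_neg one_lt_two (by linarith)
  have hpos : 0 < 1 - (2 : ℝ) ^ (h - 1) := by linarith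
  induction q, hq using Int.leInduction with
  | base =>
    rw [Finset.Icc_self, Finset.sum_singleton]
    exact le_mul_of_one_le_left (Real.rpow_nonneg (lamq_pos _).le _)
      ((one_le_inv₀ hpos).2 (by linarith))
  | succ q hq ih =>
    have hIcc : Finset.Icc (-1 : ℤ) (q + 1) = insert (q + 1) (Finset.Icc (-1) q) := by
      ext x
      simp only [Finset.mem_Icc, Finset.mem_insert]
      omega
    have hx : lamq q ^ (1 - h) = 2 ^ (h - 1) * lamq (q + 1) ^ (1 - h) := by
      rw [lamq_add_one, Real.mul_rpow two_pos.le (lamq_pos q).le, ← mul_assoc,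
        ← Real.rpow_add two_pos]
      simp
    rw [hIcc, Finset.sum_insert (by simp)]
    rw [hx] at ih
    refine (add_le_add_right ih _).trans (le_of_eq ?_)
    field_simp
    ring

/-- A lower bound `A ^ (1 / s) ≤ L` bounds `L ^ (-s) * A`. -/
lemma rpow_neg_mul_le_one {A L s : ℝ} (hA : 0 ≤ A) (hL : 0 < L) (hs : 0 < s)
    (h : A ^ (1 / s) ≤ L) : L ^ (-s) * A ≤ 1 := by
  have hle : A ≤ L ^ s := by
    have := Real.rpow_le_rpow (Real.rpow_nonneg hA _) h hs.le
    rwa [← Real.rpow_mul hA, one_div_mul_cancel hs.ne', Real.rpow_one] at this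
  rw [Real.rpow_neg hL.le, inv_mul_le_iff₀ (Real.rpow_pos_of_pos hL s), mul_one]
  exact hle

/-- On a probability space the `L^p` seminorm is bounded by the `L^∞` seminorm, without any
measurability assumption. -/
lemma eLpNorm_le_eLpNorm_top {α : Type*} [MeasurableSpace α] (μ : Measure α)
    [IsProbabilityMeasure μ] (f : α → ℝ) (p : ℝ≥0∞) : eLpNorm f p μ ≤ eLpNorm f ⊤ μ := by
  rcases eq_or_ne p 0 with rfl | hp0
  · simp
  rcases eq_or_ne p ⊤ with rfl | hpt
  · exact le_rfl
  rw [eLpNorm_eq_eLpNorm' hp0 hpt, eLpNorm_exponent_top]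
  simpa using eLpNorm'_le_eLpNormEssSup_mul_rpow_measure_univ (μ := μ) (f := f)
    (ENNReal.toReal_pos hp0 hpt)

/-- **Explicit bound on the determining wavenumber in the critical case from a Hölder
bound.**  Let `ν > 0`, `c₀ > 0`, `R ≥ 0`, `0 < h < 1`, `r > 2/h`, and let `(θ_p)_{p≥−1}`
on `𝕋² = (ℝ/ℤ)²` satisfy `‖θ_p‖_{L^∞} ≤ λ_p^{−h} R`.  Then for every `q ≥ −1` with
`λ_q ≥ max{ ((r+1)²R/(2c₀ν))^{1/(h−2/r)}, ((1−2^{h−1})⁻¹(r+1)²R/(c₀ν))^{1/h} }`: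
(i) `λ_p^{2/r} ‖θ_p‖_{L^r} ≤ 2c₀ν/(r+1)²` for every `p > q`, and
(ii) `λ_q^{−1} ∑_{p=−1}^{q} λ_p ‖θ_p‖_{L^∞} ≤ c₀ν/(r+1)²`. -/
theorem critical_wavenumber_bound (ν c₀ R h r : ℝ)
    (hν : 0 < ν) (hc₀ : 0 < c₀) (hR : 0 ≤ R) (hh0 : 0 < h) (hh1 : h < 1) (hr : 2 / h < r)
    (θ : ℤ → AddCircle (1 : ℝ) × AddCircle (1 : ℝ) → ℝ)
    (hθ : ∀ p : ℤ, -1 ≤ p → eLpNorm (θ p) ⊤ volume ≤ ENNReal.ofReal (lamq p ^ (-h) * R))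
    (q : ℤ) (hq : -1 ≤ q)
    (hlam : max (((r + 1) ^ 2 * R / (2 * c₀ * ν)) ^ (1 / (h - 2 / r)))
        (((1 - 2 ^ (h - 1))⁻¹ * (r + 1) ^ 2 * R / (c₀ * ν)) ^ (1 / h)) ≤ lamq q) :
    (∀ p : ℤ, q < p →
        ENNReal.ofReal (lamq p ^ (2 / r)) * eLpNorm (θ p) (ENNReal.ofReal r) volume
          ≤ ENNReal.ofReal (2 * c₀ * ν / (r + 1) ^ 2)) ∧
      ENNReal.ofReal ((lamq q)⁻¹) *
          ∑ p ∈ Finset.Icc (-1 : ℤ) q, ENNReal.ofReal (lamq p) * eLpNorm (θ p) ⊤ volume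
        ≤ ENNReal.ofReal (c₀ * ν / (r + 1) ^ 2) := by
  have h2h : 0 < 2 / h := by positivity
  have hr0 : 0 < r := h2h.trans hr
  have hs : 0 < h - 2 / r := by
    rw [sub_pos, div_lt_iff₀ hr0]
    rwa [div_lt_iff₀ hh0, mul_comm] at hr
  have ha1 : (2 : ℝ) ^ (h - 1) < 1 :=
    Real.rpow_lt_one_of_one_lt_of_neg one_lt_two (by linarith)
  have hC : 0 < (1 - (2 : ℝ) ^ (h - 1))⁻¹ := inv_pos.2 (by linarith)
  have hr1 : 0 < (r + 1) ^ 2 := by positivity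
  constructor
  · intro p hp
    have : IsProbabilityMeasure (volume : Measure (AddCircle (1 : ℝ))) :=
      ⟨by simp [AddCircle.measure_univ]⟩
    have : IsProbabilityMeasure (volume : Measure (AddCircle (1 : ℝ) × AddCircle (1 : ℝ))) :=
      inferInstanceAs (IsProbabilityMeasure (Measure.prod _ _))
    have hA := rpow_neg_mul_le_one (by positivity) (lamq_pos p) hs
      ((le_max_left _ _).trans (hlam.trans (lamq_mono hp.le)))
    refine (mul_le_mul_right ((eLpNorm_le_eLpNorm_top _ _ _).trans (hθ p (by omega))) _).trans ?_
    rw [← ENNReal.ofReal_mul (Real.rpow_nonneg (lamq_pos p).le _)]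
    refine ENNReal.ofReal_le_ofReal ?_
    rw [← mul_assoc, ← Real.rpow_add (lamq_pos p), le_div_iff₀ hr1,
      show 2 / r + -h = -(h - 2 / r) by ring]
    rw [mul_div_assoc', div_le_one (by positivity)] at hA
    linarith
  · have hA := rpow_neg_mul_le_one (by positivity) (lamq_pos q) hh0
      ((le_max_right _ _).trans hlam)
    have hterm : ∀ p ∈ Finset.Icc (-1 : ℤ) q,
        ENNReal.ofReal (lamq p) * eLpNorm (θ p) ⊤ volume ≤
          ENNReal.ofReal (lamq p ^ (1 - h) * R) := by
      intro p hp
      refine (mul_le_mul_right (hθ p (Finset.mem_Icc.1 hp).1) _).trans (le_of_eq ?_)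
      rw [← ENNReal.ofReal_mul (lamq_pos p).le, ← mul_assoc, sub_eq_add_neg,
        Real.rpow_add (lamq_pos p), Real.rpow_one]
    refine (mul_le_mul_right (Finset.sum_le_sum hterm) _).trans ?_
    rw [← ENNReal.ofReal_sum_of_nonneg
        fun p _ => mul_nonneg (Real.rpow_nonneg (lamq_pos p).le _) hR,
      ← ENNReal.ofReal_mul (inv_pos.2 (lamq_pos q)).le, ← Finset.sum_mul]
    refine ENNReal.ofReal_le_ofReal ?_
    rw [mul_div_assoc', div_le_one (by positivity)] at hA
    have hL : (lamq q)⁻¹ * lamq q ^ (1 - h) = lamq q ^ (-h) := by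
      rw [sub_eq_add_neg, Real.rpow_add (lamq_pos q), Real.rpow_one,
        inv_mul_cancel_left₀ (lamq_pos q).ne']
    rw [le_div_iff₀ hr1]
    calc (lamq q)⁻¹ * ((∑ p ∈ Finset.Icc (-1 : ℤ) q, lamq p ^ (1 - h)) * R) * (r + 1) ^ 2
        ≤ (lamq q)⁻¹ * (((1 - (2 : ℝ) ^ (h - 1))⁻¹ * lamq q ^ (1 - h)) * R) * (r + 1) ^ 2 := by
          have := (inv_pos.2 (lamq_pos q)).le
          gcongr
          exact sum_lamq_rpow_le hh1 hq
      _ = ((lamq q)⁻¹ * lamq q ^ (1 - h)) *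
            ((1 - (2 : ℝ) ^ (h - 1))⁻¹ * (r + 1) ^ 2 * R) := by ring
      _ ≤ c₀ * ν := by rwa [hL]
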